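/- For every integer m ≥ 2 and every real number N ≥ 5258, (7/2)·2^{−m}·(exp(4π/√N) − 1) + (m+2)·(2π/√N)^{m−1}·ζ(2)²/m! < exp(−2π/√N). -/

import Mathlib

/-- The Riemann zeta function restricted to real arguments `x > 1`. -/
noncomputable def realZeta (x : ℝ) : ℝ := ∑' n : ℕ, 1 / ((n : ℝ) + 1) ^ x

theorem realZeta_two : realZeta 2 = Real.pi ^ 2 / 6 := by
  have h := (hasSum_nat_add_iff' 1).mpr hasSum_zeta_two
  rw [realZeta, ← sub_zero (Real.pi ^ 2 / 6)]
  simpa using h.tsum_eq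

theorem realZeta_two_sq_le : realZeta 2 ^ 2 ≤ 2.74 := by
  have h : Real.pi ^ 4 ≤ 3.15 ^ 4 :=
    pow_le_pow_left₀ Real.pi_pos.le Real.pi_lt_d2.le 4
  rw [realZeta_two]
  linear_combination h / 36

theorem add_two_le_two_mul_factorial {m : ℕ} (hm : 2 ≤ m) : m + 2 ≤ 2 * m.factorial := by
  induction m, hm using Nat.le_induction with
  | base => decide
  | succ k hk ih =>
    rw [Nat.factorial_succ]
    nlinarith

theorem two_pi_div_sqrt_le {N : ℝ} (hN : 5258 ≤ N) :
    2 * Real.pi / Real.sqrt N ≤ 0.0875 := by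
  have h : 72 ≤ Real.sqrt N := Real.le_sqrt_of_sq_le (by linarith)
  rw [div_le_iff₀ (by linarith)]
  linarith [Real.pi_lt_d2]

/-- Inequality (5.3) of the paper holds for all `m ≥ 2` and all levels `N ≥ 5258`. -/
theorem odd_weight_inequality_large_N :
    ∀ (m : ℕ), 2 ≤ m → ∀ (N : ℝ), 5258 ≤ N →
      (7 / 2) * (2 : ℝ) ^ (-(m : ℝ)) * (Real.exp (4 * Real.pi / Real.sqrt N) - 1)
        + ((m : ℝ) + 2) * (2 * Real.pi / Real.sqrt N) ^ (m - 1) * realZeta 2 ^ 2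
            / (Nat.factorial m : ℝ)
        < Real.exp (-(2 * Real.pi) / Real.sqrt N) := by
  intro m hm N hN
  have ht := two_pi_div_sqrt_le hN
  have hpos : 0 ≤ 2 * Real.pi / Real.sqrt N := by positivity
  rw [show 4 * Real.pi / Real.sqrt N = 2 * (2 * Real.pi / Real.sqrt N) by ring, neg_div]
  set t := 2 * Real.pi / Real.sqrt N
  have hexp : Real.exp (2 * t) ≤ 1.22 := by
    have h := Real.one_sub_le_exp_neg (2 * t)
    have hmul : Real.exp (2 * t) * Real.exp (-(2 * t)) = 1 := by
      rw [← Real.exp_add, add_neg_cancel, Real.exp_zero]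
    nlinarith [Real.exp_pos (2 * t)]
  have hone : 1 ≤ Real.exp (2 * t) := Real.one_le_exp (by linarith)
  have htwo : (2 : ℝ) ^ (-(m : ℝ)) ≤ 1 / 4 := by
    calc (2 : ℝ) ^ (-(m : ℝ)) ≤ 2 ^ (-2 : ℝ) :=
          Real.rpow_le_rpow_of_exponent_le one_le_two (neg_le_neg (by exact_mod_cast hm))
      _ = 1 / 4 := by norm_num [Real.rpow_neg]
  have hfirst : 7 / 2 * (2 : ℝ) ^ (-(m : ℝ)) * (Real.exp (2 * t) - 1)
      ≤ 7 / 2 * (1 / 4) * 0.22 := by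
    gcongr
    · linarith
  have hpow : t ^ (m - 1) ≤ 0.0875 :=
    (pow_le_of_le_one hpos (by linarith) (by omega)).trans ht
  have hfact : (m : ℝ) + 2 ≤ 2 * m.factorial := by
    exact_mod_cast add_two_le_two_mul_factorial hm
  have hsecond : ((m : ℝ) + 2) * t ^ (m - 1) * realZeta 2 ^ 2 / m.factorial
      ≤ 2 * 0.0875 * 2.74 := by
    rw [div_le_iff₀ (by positivity)]
    calc ((m : ℝ) + 2) * t ^ (m - 1) * realZeta 2 ^ 2
        ≤ (2 * m.factorial) * 0.0875 * 2.74 := by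
          gcongr
          exact realZeta_two_sq_le
      _ = 2 * 0.0875 * 2.74 * m.factorial := by ring
  linarith [Real.one_sub_le_exp_neg t]
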